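/- With a, h as in He's model, the limit lim_{ε→0⁺} (∫_ε^∞ h(y)² dy − 1/ε) exists and is finite. -/

import Mathlib

open Filter

noncomputable def kwH (y : ℝ) : ℝ :=
  6 * (Real.exp (2 * y) + 1) * Real.exp (2 * y) /
    ((Real.exp (4 * y) + 4 * Real.exp (2 * y) + 1) * (Real.exp (2 * y) - 1))

/-- An elementary primitive of `kwH ^ 2` on `(0, ∞)`. -/
noncomputable def kwPrimitive (y : ℝ) : ℝ :=
  (2 * Real.exp (2 * y) + 1) / (Real.exp (4 * y) + 4 * Real.exp (2 * y) + 1) -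
    2 / (Real.exp (2 * y) - 1)

lemma exp_four_mul (y : ℝ) : Real.exp (4 * y) = Real.exp (2 * y) ^ 2 := by
  rw [← Real.exp_nat_mul]
  congr 1
  push_cast
  ring

lemma exp_two_mul_sub_one_pos {y : ℝ} (hy : 0 < y) : 0 < Real.exp (2 * y) - 1 :=
  sub_pos.2 (Real.one_lt_exp_iff.2 (by positivity))

lemma hasDerivAt_kwPrimitive {y : ℝ} (hy : 0 < y) :
    HasDerivAt kwPrimitive (kwH y ^ 2) y := by
  have hu := (exp_two_mul_sub_one_pos hy).ne'
  have hq : Real.exp (4 * y) + 4 * Real.exp (2 * y) + 1 ≠ 0 := by positivity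
  have h2 : HasDerivAt (fun y : ℝ => Real.exp (2 * y)) (Real.exp (2 * y) * (2 * 1)) y :=
    ((hasDerivAt_id' y).const_mul 2).exp
  have h4 : HasDerivAt (fun y : ℝ => Real.exp (4 * y)) (Real.exp (4 * y) * (4 * 1)) y :=
    ((hasDerivAt_id' y).const_mul 4).exp
  have h := (((h2.const_mul 2).add_const 1).fun_div ((h4.fun_add (h2.const_mul 4)).add_const 1)
    hq).fun_sub ((hasDerivAt_const y (2 : ℝ)).fun_div (h2.sub_const 1) hu)
  refine h.congr_deriv ?_
  rw [kwH]
  rw [exp_four_mul] at hq ⊢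
  generalize Real.exp (2 * y) = u at hu hq ⊢
  rw [div_pow, div_sub_div _ _ (pow_ne_zero 2 hq) (pow_ne_zero 2 hu)]
  congr 1 <;> ring

lemma tendsto_kwPrimitive_atTop : Tendsto kwPrimitive atTop (nhds 0) := by
  have hexp : Tendsto (fun y : ℝ => Real.exp (2 * y)) atTop atTop :=
    Real.tendsto_exp_atTop.comp (tendsto_id.const_mul_atTop two_pos)
  have hinv : Tendsto (fun y : ℝ => 2 / Real.exp (2 * y)) atTop (nhds 0) :=
    hexp.const_div_atTop 2
  have hsub : Tendsto (fun y : ℝ => 2 / (Real.exp (2 * y) - 1)) atTop (nhds 0) :=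
    (tendsto_atTop_add_const_right _ (-1) hexp).const_div_atTop 2
  have hquot : Tendsto (fun y : ℝ => (2 * Real.exp (2 * y) + 1) /
      (Real.exp (4 * y) + 4 * Real.exp (2 * y) + 1)) atTop (nhds 0) := by
    refine squeeze_zero (fun y => by positivity) (fun y => ?_) hinv
    have hu := Real.exp_pos (2 * y)
    rw [exp_four_mul, div_le_div_iff₀ (by positivity) hu]
    nlinarith
  have h := hquot.sub hsub
  rw [sub_zero] at h
  exact h

lemma integral_Ioi_kwH_sq {ε : ℝ} (hε : 0 < ε) :
    ∫ y in Set.Ioi ε, kwH y ^ 2 = -kwPrimitive ε := by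
  rw [MeasureTheory.integral_Ioi_of_hasDerivAt_of_nonneg'
    (fun y hy => hasDerivAt_kwPrimitive (hε.trans_le hy)) (fun y _ => sq_nonneg _)
    tendsto_kwPrimitive_atTop, zero_sub]

lemma tendsto_two_div_exp_sub_one_sub_inv :
    Tendsto (fun ε : ℝ => 2 / (Real.exp (2 * ε) - 1) - 1 / ε)
      (nhdsWithin 0 (Set.Ioi 0)) (nhds (-1)) := by
  have hquad : Tendsto (fun x : ℝ => (Real.exp x - 1 - x - x ^ 2 / 2) / x ^ 2)
      (nhds 0) (nhds 0) := by
    have hO := Real.exp_sub_sum_range_isBigO_pow 3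
    have ho : (fun x : ℝ => x ^ 3) =o[nhds 0] (fun x : ℝ => x ^ 2) :=
      Asymptotics.isLittleO_pow_pow (by norm_num)
    refine (hO.trans_isLittleO ho).tendsto_div_nhds_zero.congr fun x => ?_
    simp [Finset.sum_range_succ, Nat.factorial]
    ring
  have hlin : Tendsto (fun ε : ℝ => 2 * ε) (nhdsWithin 0 (Set.Ioi 0)) (nhds 0) := by
    refine Tendsto.mono_left ?_ nhdsWithin_le_nhds
    simpa using (continuous_const_mul (2 : ℝ)).tendsto 0
  have hr := hquad.comp hlin
  have h := ((hr.add_const (1 / 2)).const_mul (-2)).div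
    (((hlin.mul (hr.add_const (1 / 2))).const_add 1)) (by norm_num)
  norm_num at h
  refine h.congr' ?_
  filter_upwards [self_mem_nhdsWithin] with ε hε
  have hε' : 0 < ε := hε
  have hu := (exp_two_mul_sub_one_pos hε').ne'
  have hden : 1 + 2 * ε * ((Real.exp (2 * ε) - 1 - 2 * ε - (2 * ε) ^ 2 / 2) / (2 * ε) ^ 2 + 1 / 2)
      = (Real.exp (2 * ε) - 1) / (2 * ε) := by
    field_simp
    ring
  have hnum : (Real.exp (2 * ε) - 1 - 2 * ε - (2 * ε) ^ 2 / 2) / (2 * ε) ^ 2 + 1 / 2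
      = (Real.exp (2 * ε) - 1 - 2 * ε) / (2 * ε) ^ 2 := by
    field_simp
    ring
  simp only [Pi.div_apply]
  rw [hden, hnum]
  field_simp
  ring

/-- The scalar content of equation (3.11): since `h(y) = 1/y + O(y)` near `0`
and `h` decays exponentially at `∞`, the limit
`lim_{ε→0⁺} (∫_ε^∞ h(y)² dy − 1/ε)` exists and is finite. -/
theorem kw_regularized_higgs_energy_limit_exists :
    ∃ L : ℝ, Tendsto (fun ε : ℝ => (∫ y in Set.Ioi ε, (kwH y) ^ 2) - 1 / ε)
      (nhdsWithin 0 (Set.Ioi 0)) (nhds L) := by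
  refine ⟨-(3 / 2), ?_⟩
  have hlim : Tendsto (fun ε : ℝ => (2 / (Real.exp (2 * ε) - 1) - 1 / ε) -
      (2 * Real.exp (2 * ε) + 1) / (Real.exp (4 * ε) + 4 * Real.exp (2 * ε) + 1))
      (nhdsWithin 0 (Set.Ioi 0)) (nhds (-1 - 1 / 2)) := by
    refine tendsto_two_div_exp_sub_one_sub_inv.sub (Tendsto.mono_left ?_ nhdsWithin_le_nhds)
    have hc : ContinuousAt (fun ε : ℝ => (2 * Real.exp (2 * ε) + 1) /
        (Real.exp (4 * ε) + 4 * Real.exp (2 * ε) + 1)) 0 :=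
      ContinuousAt.div (by fun_prop) (by fun_prop) (by positivity)
    convert hc.tendsto using 2
    norm_num
  rw [show (-(3 / 2) : ℝ) = -1 - 1 / 2 by norm_num]
  refine hlim.congr' ?_
  filter_upwards [self_mem_nhdsWithin] with ε hε
  rw [integral_Ioi_kwH_sq hε, kwPrimitive]
  ring
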